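/- arXiv:1710.08622 — 3 statements merged into one kernel-verified Lean document; each statement's English description precedes it below -/
import Mathlib

section
/- Suppose T ∈ B(H) can be written as T = (I+Y)^{1/2} Z (I−Y)^{1/2} where Y is a selfadjoint contraction and Z is a contraction on H. Then the numerical radius of T is at most 1. -/
set_option synthInstance.maxHeartbeats 1000000
open scoped InnerProductSpace
open ContinuousLinearMap

namespace ContinuousLinearMap

variable {H : Type*} [NormedAddCommGroup H] [InnerProductSpace ℂ H] [CompleteSpace H]

lemma one_add_nonneg_of_norm_le_one {Y : H →L[ℂ] H} (hY : IsSelfAdjoint Y) (hYnorm : ‖Y‖ ≤ 1) :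
    0 ≤ 1 + Y := by
  rw [nonneg_iff_isPositive, isPositive_def']
  refine ⟨(IsSelfAdjoint.one _).add hY, fun x => ?_⟩
  have h : ‖⟪Y x, x⟫_ℂ‖ ≤ ‖x‖ * ‖x‖ :=
    (norm_inner_le_norm _ _).trans (by gcongr; simpa using Y.le_of_opNorm_le hYnorm x)
  have h_re := (abs_le.mp ((Complex.abs_re_le_norm _).trans h)).1
  have h_self := inner_self_eq_norm_mul_norm (𝕜 := ℂ) x
  simp only [RCLike.re_to_complex] at h_self
  simp only [reApplyInnerSelf_apply, add_apply, one_apply_eq_self, inner_add_left, map_add,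
    RCLike.re_to_complex]
  linarith

lemma inner_sqrt_apply_left (A : H →L[ℂ] H) (x y : H) :
    ⟪CFC.sqrt A x, y⟫_ℂ = ⟪x, CFC.sqrt A y⟫_ℂ :=
  (IsSelfAdjoint.of_nonneg (CFC.sqrt_nonneg A)).isSymmetric x y

lemma norm_sqrt_apply_sq {A : H →L[ℂ] H} (hA : 0 ≤ A) (x : H) :
    ‖CFC.sqrt A x‖ ^ 2 = (⟪A x, x⟫_ℂ).re := by
  rw [← inner_self_eq_norm_sq (𝕜 := ℂ), ← inner_sqrt_apply_left, ← mul_apply_eq_comp,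
    CFC.sqrt_mul_sqrt_self A hA, RCLike.re_to_complex]

lemma norm_sqrt_one_add_sq_add_norm_sqrt_one_sub_sq {Y : H →L[ℂ] H} (hY : IsSelfAdjoint Y)
    (hYnorm : ‖Y‖ ≤ 1) (x : H) :
    ‖CFC.sqrt (1 + Y) x‖ ^ 2 + ‖CFC.sqrt (1 - Y) x‖ ^ 2 = 2 * ‖x‖ ^ 2 := by
  have h_sub : 0 ≤ 1 - Y := by
    simpa [sub_eq_add_neg] using one_add_nonneg_of_norm_le_one hY.neg (by simpa using hYnorm)
  rw [norm_sqrt_apply_sq (one_add_nonneg_of_norm_le_one hY hYnorm), norm_sqrt_apply_sq h_sub,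
    ← inner_self_eq_norm_sq (𝕜 := ℂ) x]
  simp only [add_apply, sub_apply, one_apply_eq_self, inner_add_left, inner_sub_left, Complex.add_re,
    Complex.sub_re, RCLike.re_to_complex]
  ring

end ContinuousLinearMap

/-- If `T = (I+Y)^{1/2} Z (I-Y)^{1/2}` with `Y` a selfadjoint contraction and
`Z` a contraction, then the numerical radius of `T` is at most `1`. -/
theorem numericalRadius_le_one_of_ando_decomposition
    {H : Type*} [NormedAddCommGroup H] [InnerProductSpace ℂ H] [CompleteSpace H]
    (T Y Z : H →L[ℂ] H) (hY : IsSelfAdjoint Y) (hYnorm : ‖Y‖ ≤ 1) (hZ : ‖Z‖ ≤ 1)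
    (hT : T = CFC.sqrt ((1 : H →L[ℂ] H) + Y) * Z * CFC.sqrt ((1 : H →L[ℂ] H) - Y)) :
    ∀ ξ : H, ‖ξ‖ = 1 → ‖⟪T ξ, ξ⟫_ℂ‖ ≤ 1 := by
  intro ξ hξ
  have h_sum := norm_sqrt_one_add_sq_add_norm_sqrt_one_sub_sq hY hYnorm ξ
  rw [hξ] at h_sum
  rw [hT, mul_apply_eq_comp, mul_apply_eq_comp, inner_sqrt_apply_left]
  calc _ ≤ ‖Z (CFC.sqrt (1 - Y) ξ)‖ * ‖CFC.sqrt (1 + Y) ξ‖ := norm_inner_le_norm _ _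
    _ ≤ ‖CFC.sqrt (1 - Y) ξ‖ * ‖CFC.sqrt (1 + Y) ξ‖ := by
      gcongr
      simpa using Z.le_of_opNorm_le hZ (CFC.sqrt (1 - Y) ξ)
    _ ≤ 1 := by nlinarith [sq_nonneg (‖CFC.sqrt (1 - Y) ξ‖ - ‖CFC.sqrt (1 + Y) ξ‖)]
end

section
/- Let T be an n×n positive semidefinite Hermitian Toeplitz matrix with entries a_{j−k} (where a_{−k} = conj(a_k)). Then there exists a positive linear functional φ on C(𝕋) such that φ(z^k) = a_k for k = 0, 1, …, n−1. -/
open scoped ComplexOrder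

open scoped InnerProductSpace

section GramMatrix

variable {𝕜 E : Type*} [RCLike 𝕜] [NormedAddCommGroup E] [InnerProductSpace 𝕜 E]
  [FiniteDimensional 𝕜 E]

/-- Two linear maps into a finite-dimensional inner product space with the same pointwise norms
differ by a linear isometry. -/
theorem LinearMap.exists_linearIsometry_comp_eq {V : Type*} [AddCommGroup V] [Module 𝕜 V]
    (f g : V →ₗ[𝕜] E) (h : ∀ x, ‖f x‖ = ‖g x‖) : ∃ U : E →ₗᵢ[𝕜] E, ∀ x, U (f x) = g x := by
  obtain ⟨s, hs⟩ := f.rangeRestrict.exists_rightInverse_of_surjective f.range_rangeRestrict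
  have hfs (y : range f) : f (s y) = y := congrArg Subtype.val (LinearMap.congr_fun hs y)
  let L : range f →ₗᵢ[𝕜] E := ⟨g ∘ₗ s, fun y => by simp [← h, hfs]⟩
  refine ⟨L.extend, fun x => ?_⟩
  have hx : g (s (f.rangeRestrict x) - x) = 0 := by
    rw [← norm_eq_zero, ← h, map_sub, hfs]
    simp
  rw [map_sub, sub_eq_zero] at hx
  exact (L.extend_apply (f.rangeRestrict x)).trans hx

/-- Two families of vectors with the same Gram matrix differ by a unitary operator. -/
theorem Matrix.exists_unitary_of_gram_eq {ι : Type*} [Fintype ι] [CompleteSpace E] (v w : ι → E)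
    (h : Matrix.gram 𝕜 v = Matrix.gram 𝕜 w) :
    ∃ U ∈ unitary (E →L[𝕜] E), ∀ i, U (v i) = w i := by
  classical
  obtain ⟨U, hU⟩ := LinearMap.exists_linearIsometry_comp_eq
    (Fintype.linearCombination 𝕜 v) (Fintype.linearCombination 𝕜 w) fun x => by
      rw [@norm_eq_sqrt_re_inner 𝕜, @norm_eq_sqrt_re_inner 𝕜]
      simp only [Fintype.linearCombination_apply, ← Matrix.star_dotProduct_gram_mulVec, h]
  refine ⟨_, (Unitary.linearIsometryEquiv.symm (U.toLinearIsometryEquiv rfl)).2, fun i => ?_⟩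
  simpa using hU (Pi.single i 1)

end GramMatrix

/-- The positive functional `f ↦ ⟪ξ, f(U) ξ⟫` on `C(𝕋)` given by a unitary operator `U` and a
vector `ξ`. -/
theorem exists_positive_functional_of_unitary {H : Type*} [NormedAddCommGroup H]
    [InnerProductSpace ℂ H] [CompleteSpace H] {U : H →L[ℂ] H} (hU : U ∈ unitary (H →L[ℂ] H))
    (ξ : H) :
    ∃ φ : C(Circle, ℂ) →ₗ[ℂ] ℂ,
      (∀ f : C(Circle, ℂ), (∀ x, 0 ≤ f x) → 0 ≤ φ f) ∧
      ∀ k : ℕ, φ ⟨fun x => (x : ℂ) ^ k, by fun_prop⟩ = ⟪ξ, (U ^ k) ξ⟫_ℂ := by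
  have hn : IsStarNormal U := ⟨by
    rw [Commute, SemiconjBy, Unitary.star_mul_self_of_mem hU, Unitary.mul_star_self_of_mem hU]⟩
  let ι : C(spectrum ℂ U, Circle) :=
    ⟨fun z => ⟨z, by
      simpa [Submonoid.unitSphere] using spectrum.subset_circle_of_unitary hU z.2⟩, by fun_prop⟩
  let Φ : C(Circle, ℂ) →⋆ₐ[ℂ] (H →L[ℂ] H) :=
    (cfcHom hn).comp (ι.compStarAlgHom' ℂ ℂ)
  refine ⟨(innerSL ℂ ξ).toLinearMap ∘ₗ
    (ContinuousLinearMap.apply ℂ H ξ).toLinearMap ∘ₗ Φ.toAlgHom.toLinearMap,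
    fun f hf => ?_, fun k => ?_⟩
  · have h : 0 ≤ Φ f := (cfcHom_nonneg_iff hn).2 fun z => hf (ι z)
    exact (ContinuousLinearMap.nonneg_iff_isPositive _ |>.1 h).inner_nonneg_right ξ
  · have h : Φ ⟨fun x => (x : ℂ) ^ k, by fun_prop⟩ = U ^ k := by
      conv_rhs => rw [← cfcHom_id (R := ℂ) hn, ← map_pow]
      rfl
    exact congrArg (fun A : H →L[ℂ] H => ⟪ξ, A ξ⟫_ℂ) h

/-- if a Hermitian Toeplitz matrix with entries `a_{j-k}` (and `a₋ₖ = conj aₖ`)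
is positive semidefinite, then its entries are the moments `aₖ = φ(zᵏ)`, `k = 0, …, n-1`, of
some positive linear functional `φ` on `C(𝕋)`. -/
theorem positive_functional_of_posSemidef_toeplitz (n : ℕ) (a : ℕ → ℂ)
    (hT : Matrix.PosSemidef (Matrix.of fun j k : Fin n =>
      if (k : ℕ) ≤ (j : ℕ) then a ((j : ℕ) - (k : ℕ))
      else starRingEnd ℂ (a ((k : ℕ) - (j : ℕ))))) :
    ∃ φ : C(Circle, ℂ) →ₗ[ℂ] ℂ,
      (∀ f : C(Circle, ℂ), (∀ x, 0 ≤ f x) → 0 ≤ φ f) ∧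
      ∀ k < n, φ ⟨fun x => (x : ℂ) ^ k, by fun_prop⟩ = a k := by
  obtain _ | n := n
  · exact ⟨0, by simp, by simp⟩
  obtain ⟨m, v, hv⟩ := Matrix.posSemidef_iff_eq_sum_vecMulVec.1 hT
  let u (j : Fin (n + 1)) : EuclideanSpace ℂ (Fin m) := WithLp.toLp 2 fun i => v i j
  have hu (j k : Fin (n + 1)) : ⟪u k, u j⟫_ℂ = if (k : ℕ) ≤ (j : ℕ) then a ((j : ℕ) - (k : ℕ))
      else starRingEnd ℂ (a ((k : ℕ) - (j : ℕ))) := by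
    have := congrFun₂ hv j k
    simp only [Matrix.of_apply] at this
    rw [this]
    simp [u, PiLp.inner_apply, Matrix.sum_apply, Matrix.vecMulVec_apply]
  obtain ⟨U, hU, hUu⟩ := Matrix.exists_unitary_of_gram_eq (𝕜 := ℂ)
    (fun i : Fin n => u i.castSucc) (fun i => u i.succ) (by
      ext i j
      simp [Matrix.gram_apply, hu])
  have hpow (k : ℕ) (hk : k < n + 1) : (U ^ k) (u 0) = u ⟨k, hk⟩ := by
    induction k with
    | zero => rfl
    | succ k ih =>
      rw [pow_succ', mul_apply_eq_comp, ih (by omega)]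
      exact hUu ⟨k, by omega⟩
  obtain ⟨φ, hφ, hφU⟩ := exists_positive_functional_of_unitary hU (u 0)
  refine ⟨φ, hφ, fun k hk => ?_⟩
  rw [hφU, hpow k hk, hu]
  simp
end

section
/- Let T ∈ M_n(ℂ) with ‖T‖ ≤ 1, and suppose I + 2·Re(Σ_{k=1}^{n−1} λ^k T^k) ≥ 0 for all λ on the unit circle. Then the linear map ψ defined on span{S_n^j, (S_n*)^j : 0 ≤ j ≤ n−1} ⊆ M_n(ℂ) by ψ(S_n^j) = T^j and ψ((S_n*)^j) = (T*)^j is completely positive and unital. -/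
open Matrix
open scoped ComplexOrder

/-- The `n × n` lower-shift matrix. -/
def lowerShift (n : ℕ) : Matrix (Fin n) (Fin n) ℂ :=
  Matrix.of fun i j => if (i : ℕ) = (j : ℕ) + 1 then 1 else 0

theorem exists_linearIsometry_of_inner_eq {ι V : Type*} [Fintype ι] [NormedAddCommGroup V]
    [InnerProductSpace ℂ V] [FiniteDimensional ℂ V] (v w : ι → V)
    (h : ∀ i j, inner ℂ (v i) (v j) = inner ℂ (w i) (w j)) :
    ∃ U : V →ₗᵢ[ℂ] V, ∀ i, U (v i) = w i := by
  classical
  let X := Fintype.linearCombination ℂ v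
  let Y := Fintype.linearCombination ℂ w
  have hXY : ∀ c, ‖X c‖ = ‖Y c‖ := by
    intro c
    have : inner ℂ (X c) (X c) = inner ℂ (Y c) (Y c) := by
      simp only [X, Y, Fintype.linearCombination_apply, sum_inner, inner_sum, inner_smul_left,
        inner_smul_right, h]
    rw [@norm_eq_sqrt_re_inner ℂ, @norm_eq_sqrt_re_inner ℂ, this]
  have hker : X.ker ≤ Y.ker := by
    intro c hc
    rw [LinearMap.mem_ker] at hc ⊢
    rw [← norm_eq_zero, ← hXY, hc, norm_zero]
  let L₀ : X.range →ₗ[ℂ] V := (X.ker.liftQ Y hker) ∘ₗ X.quotKerEquivRange.symm.toLinearMap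
  have hL₀ : ∀ c (hc : X c ∈ X.range), L₀ ⟨X c, hc⟩ = Y c := by
    intro c hc
    have : X.quotKerEquivRange.symm ⟨X c, hc⟩ = X.ker.mkQ c := by
      rw [LinearEquiv.symm_apply_eq]
      rfl
    simp [L₀, this]
  let L : X.range →ₗᵢ[ℂ] V := ⟨L₀, by
    rintro ⟨_, c, rfl⟩
    exact (congrArg norm (hL₀ c (LinearMap.mem_range_self _ _))).trans (hXY c).symm⟩
  refine ⟨L.extend, fun i => ?_⟩
  have hX : X (Pi.single i 1) = v i := by simp [X]
  have hY : Y (Pi.single i 1) = w i := by simp [Y]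
  have := L.extend_apply ⟨X (Pi.single i 1), LinearMap.mem_range_self _ _⟩
  rw [← hX, ← hY, ← hL₀ _ (LinearMap.mem_range_self _ _)]
  exact this

theorem unitary_pow_eq_sum_smul {V : Type*} [NormedAddCommGroup V]
    [InnerProductSpace ℂ V] [FiniteDimensional ℂ V] [CompleteSpace V] (u : V →L[ℂ] V)
    (hu : u ∈ unitary (V →L[ℂ] V)) :
    ∃ (σ : Finset ℂ) (P : ℂ → V →L[ℂ] V), (∀ z ∈ σ, ‖z‖ = 1) ∧
      ∀ d : ℕ, u ^ d = ∑ z ∈ σ, z ^ d • (star (P z) * P z) := by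
  classical
  have hn : IsStarNormal u := ⟨(Unitary.star_mul_self_of_mem hu).trans
    (Unitary.mul_star_self_of_mem hu).symm⟩
  have hfin : (spectrum ℂ u).Finite := by
    have := Module.End.finite_spectrum (K := ℂ) (V := V) (u : V →ₗ[ℂ] V)
    refine this.subset ?_
    exact AlgHom.spectrum_apply_subset
      (Module.End.toContinuousLinearMap V : _ ≃ₐ[ℂ] _) (u : V →ₗ[ℂ] V)
  have hc : ∀ f : ℂ → ℂ, ContinuousOn f (spectrum ℂ u) := fun f => hfin.continuousOn f
  refine ⟨hfin.toFinset, fun z => cfc (fun x => if x = z then (1 : ℂ) else 0) u, ?_, ?_⟩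
  · intro z hz
    simpa using spectrum.subset_circle_of_unitary hu (hfin.mem_toFinset.1 hz)
  · intro d
    have h1 : ∀ z : ℂ, z ^ d • (star (cfc (fun x => if x = z then (1 : ℂ) else 0) u) *
        cfc (fun x => if x = z then (1 : ℂ) else 0) u) =
        cfc (fun x => if x = z then z ^ d else 0) u := by
      intro z
      rw [← cfc_star, ← cfc_mul _ _ u (hc _) (hc _), ← cfc_smul _ _ u (hc _)]
      congr 1
      ext x
      split_ifs <;> simp
    simp_rw [h1]
    rw [← cfc_sum _ u _ (fun z _ => hc _), ← cfc_pow_id (R := ℂ) u d]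
    refine cfc_congr fun x hx => ?_
    simp [hx]

theorem inner_eq_sum_of_toeplitz {m : ℕ} {κ V : Type*} [Fintype κ] [NormedAddCommGroup V]
    [InnerProductSpace ℂ V] [FiniteDimensional ℂ V] (g : Fin (m + 1) → κ → V)
    (hg : ∀ (i j : Fin m) (p q : κ),
      inner ℂ (g i.succ p) (g j.succ q) = inner ℂ (g i.castSucc p) (g j.castSucc q)) :
    ∃ (σ : Finset ℂ) (h : ℂ → κ → V), (∀ z ∈ σ, ‖z‖ = 1) ∧
      ∀ (d : Fin (m + 1)) (p q : κ),
        inner ℂ (g d p) (g 0 q) =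
          ∑ z ∈ σ, starRingEnd ℂ z ^ (d : ℕ) * inner ℂ (h z p) (h z q) := by
  have : CompleteSpace V := FiniteDimensional.complete ℂ V
  obtain ⟨U, hU⟩ := exists_linearIsometry_of_inner_eq
    (fun a : Fin m × κ => g a.1.castSucc a.2) (fun a => g a.1.succ a.2)
    (fun a b => (hg a.1 b.1 a.2 b.2).symm)
  let u : V →L[ℂ] V := U.toContinuousLinearMap
  have hu1 : star u * u = 1 := by
    rw [ContinuousLinearMap.star_eq_adjoint]
    exact U.adjoint_comp_self
  have hu2 : u * star u = 1 := by
    have h1 : ((star u : V →L[ℂ] V) : V →ₗ[ℂ] V) * (u : V →ₗ[ℂ] V) = 1 :=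
      congrArg ContinuousLinearMap.toLinearMap hu1
    have h2 := mul_eq_one_comm.1 h1
    ext x
    exact LinearMap.congr_fun h2 x
  obtain ⟨σ, P, hσ, hP⟩ := unitary_pow_eq_sum_smul u ⟨hu1, hu2⟩
  have hgu : ∀ (d : ℕ) (hd : d < m + 1) (p : κ), g ⟨d, hd⟩ p = (u ^ d) (g 0 p) := by
    intro d
    induction d with
    | zero => intro hd p; rfl
    | succ d ih =>
      intro hd p
      rw [pow_succ', mul_apply_eq_comp, ← ih (by omega)]
      exact (hU (⟨d, by omega⟩, p)).symm
  refine ⟨σ, fun z p => P z (g 0 p), hσ, ?_⟩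
  rintro ⟨d, hd⟩ p q
  rw [hgu, hP]
  simp only [_root_.sum_apply, sum_inner]
  refine Finset.sum_congr rfl fun z _ => ?_
  rw [_root_.smul_apply, inner_smul_left, mul_apply_eq_comp,
    ContinuousLinearMap.star_eq_adjoint, ContinuousLinearMap.adjoint_inner_left, map_pow]

theorem lowerShift_pow_apply (n d : ℕ) (i j : Fin n) :
    (lowerShift n ^ d) i j = if (i : ℕ) = j + d then 1 else 0 := by
  induction d generalizing i with
  | zero => simp [Matrix.one_apply, Fin.ext_iff]
  | succ d ih =>
    rw [pow_succ', Matrix.mul_apply]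
    simp only [ih]
    by_cases h : (i : ℕ) = j + (d + 1)
    · rw [if_pos h, Finset.sum_eq_single ⟨j + d, by omega⟩]
      · simp [lowerShift, h, add_assoc]
      · intro b _ hb
        rw [if_neg (fun hb' => hb (Fin.ext hb')), mul_zero]
      · simp
    · rw [if_neg h]
      refine Finset.sum_eq_zero fun b _ => ?_
      by_cases hb : (b : ℕ) = j + d
      · rw [lowerShift, Matrix.of_apply, if_neg (by omega), zero_mul]
      · rw [if_neg hb, mul_zero]

/-- The operator system spanned by powers of the shift and their adjoints. -/
def shiftSystem (n : ℕ) : Submodule ℂ (Matrix (Fin n) (Fin n) ℂ) :=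
  Submodule.span ℂ
    {M | ∃ j : ℕ, j ≤ n - 1 ∧ (M = (lowerShift n) ^ j ∨ M = ((lowerShift n) ^ j)ᴴ)}

theorem apply_succ_succ_of_mem_shiftSystem {m : ℕ}
    {x : Matrix (Fin (m + 1)) (Fin (m + 1)) ℂ} (hx : x ∈ shiftSystem (m + 1)) (i j : Fin m) :
    x i.succ j.succ = x i.castSucc j.castSucc := by
  induction hx using Submodule.span_induction with
  | mem x hx =>
    obtain ⟨d, -, rfl | rfl⟩ := hx <;>
    simp [Matrix.conjTranspose_apply, lowerShift_pow_apply, add_right_comm _ 1 d]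
  | zero => rfl
  | add x y _ _ hx hy => simp [hx, hy]
  | smul a x _ hx => simp [hx]

theorem map_shiftSystem_apply {m : ℕ} {N : Type*} [AddCommGroup N] [Module ℂ N]
    (ψ : shiftSystem (m + 1) →ₗ[ℂ] N) (t t' : ℕ → N) (ht : t' 0 = t 0)
    (hψ : ∀ (x : shiftSystem (m + 1)) (j : ℕ), j ≤ m →
      (((x : Matrix _ _ ℂ) = lowerShift (m + 1) ^ j → ψ x = t j) ∧
       ((x : Matrix _ _ ℂ) = (lowerShift (m + 1) ^ j)ᴴ → ψ x = t' j)))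
    (x : shiftSystem (m + 1)) :
    ψ x = x.1 0 0 • t 0 + ∑ d ∈ Finset.Icc 1 m,
      (x.1 (Fin.ofNat (m + 1) d) 0 • t d + x.1 0 (Fin.ofNat (m + 1) d) • t' d) := by
  obtain ⟨x, hx⟩ := x
  induction hx using Submodule.span_induction with
  | mem x hx' =>
    obtain ⟨j, hj, h⟩ := hx'
    have hj' : j ≤ m := hj
    have h0 : (lowerShift (m + 1) ^ j) 0 0 = if j = 0 then 1 else 0 := by
      simp [lowerShift_pow_apply, eq_comm]
    have hv : ∀ d ∈ Finset.Icc 1 m, ((Fin.ofNat (m + 1) d : Fin (m + 1)) : ℕ) = d := fun d hd =>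
      Nat.mod_eq_of_lt (by have := Finset.mem_Icc.1 hd; omega)
    have hl : ∀ d ∈ Finset.Icc 1 m, (lowerShift (m + 1) ^ j) (Fin.ofNat (m + 1) d) 0 =
        if d = j then 1 else 0 := fun d hd => by
      rw [lowerShift_pow_apply, hv d hd, Fin.val_zero, zero_add]
    have hu : ∀ d ∈ Finset.Icc 1 m, (lowerShift (m + 1) ^ j) 0 (Fin.ofNat (m + 1) d) = 0 :=
      fun d hd => by
        rw [lowerShift_pow_apply, hv d hd, Fin.val_zero, if_neg]
        have := Finset.mem_Icc.1 hd
        omega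
    have hsum : ∀ r : ℕ → N, (if j = 0 then (1 : ℂ) else 0) • r 0 +
        ∑ d ∈ Finset.Icc 1 m, (if d = j then (1 : ℂ) else 0) • r d = r j := by
      intro r
      rcases Nat.eq_zero_or_pos j with rfl | hj0
      · simp
      · simp [hj0.ne', hj', Nat.one_le_iff_ne_zero]
    rcases h with rfl | rfl
    · rw [(hψ _ j hj').1 rfl, ← hsum t]
      simp only [h0]
      congr 1
      refine Finset.sum_congr rfl fun d hd => ?_
      rw [hl d hd, hu d hd, zero_smul, add_zero]
    · rw [(hψ _ j hj').2 rfl, ← hsum t', ht]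
      simp only [Matrix.conjTranspose_apply, h0]
      congr 1
      · split_ifs <;> simp
      · refine Finset.sum_congr rfl fun d hd => ?_
        rw [hl d hd, hu d hd, star_zero, zero_smul, zero_add]
        split_ifs <;> simp
  | zero =>
    have : (⟨0, Submodule.zero_mem _⟩ : shiftSystem (m + 1)) = 0 := rfl
    simp [this]
  | add x y hx hy ihx ihy =>
    have : (⟨x + y, Submodule.add_mem _ hx hy⟩ : shiftSystem (m + 1)) = ⟨x, hx⟩ + ⟨y, hy⟩ := rfl
    rw [this, map_add, ihx, ihy]
    simp only [Submodule.coe_add, Matrix.add_apply, add_smul, Finset.sum_add_distrib]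
    abel
  | smul a x hx ihx =>
    have : (⟨a • x, Submodule.smul_mem _ a hx⟩ : shiftSystem (m + 1)) = a • ⟨x, hx⟩ := rfl
    rw [this, map_smul, ihx]
    simp only [Submodule.coe_smul, Matrix.smul_apply, smul_add, smul_smul, Finset.smul_sum,
      smul_eq_mul]

open scoped MatrixOrder in
theorem exists_eq_conjTranspose_mul_self_of_comp_posSemidef {ι κ : Type*} [Fintype ι]
    [Fintype κ] {M : Matrix κ κ (Matrix ι ι ℂ)}
    (hM : (Matrix.comp κ κ ι ι ℂ M).PosSemidef) :
    ∃ P : Matrix κ κ (Matrix ι ι ℂ), M = Pᴴ * P := by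
  classical
  obtain ⟨B, hB⟩ := CStarAlgebra.nonneg_iff_eq_star_mul_self.mp hM.nonneg
  refine ⟨(Matrix.comp κ κ ι ι ℂ).symm B, ?_⟩
  ext p q i j
  have := congrFun (congrFun hB (p, i)) (q, j)
  rw [Matrix.star_eq_conjTranspose, Matrix.mul_apply, Fintype.sum_prod_type] at this
  rw [Matrix.mul_apply, Matrix.sum_apply]
  exact this

/-- Arveson: if `‖T‖ ≤ 1` and `I + 2 Re (∑_{k=1}^{n-1} λᵏ Tᵏ) ≥ 0` for every
`λ` on the unit circle, then the linear map `ψ` defined on the operator system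
`span {Sₙʲ, (Sₙ*)ʲ : 0 ≤ j ≤ n-1}` by `ψ(Sₙʲ) = Tʲ` and `ψ((Sₙ*)ʲ) = (T*)ʲ` is unital and
completely positive. -/
theorem arveson_shift_system_ucp (n : ℕ) (hn : 2 ≤ n) (T : Matrix (Fin n) (Fin n) ℂ)
    (hT : ∀ x : EuclideanSpace ℂ (Fin n), ‖Matrix.toEuclideanLin T x‖ ≤ ‖x‖)
    (hpos : ∀ lam : ℂ, ‖lam‖ = 1 →
      ((1 : Matrix (Fin n) (Fin n) ℂ) + ∑ k ∈ Finset.Icc 1 (n - 1),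
        (lam ^ k • T ^ k + (starRingEnd ℂ lam) ^ k • (T ^ k)ᴴ)).PosSemidef)
    (O : Submodule ℂ (Matrix (Fin n) (Fin n) ℂ))
    (hO : O = Submodule.span ℂ
      {M | ∃ j : ℕ, j ≤ n - 1 ∧ (M = (lowerShift n) ^ j ∨ M = ((lowerShift n) ^ j)ᴴ)})
    (ψ : O →ₗ[ℂ] Matrix (Fin n) (Fin n) ℂ)
    (hψ : ∀ (x : O) (j : ℕ), j ≤ n - 1 →
      (((x : Matrix (Fin n) (Fin n) ℂ) = (lowerShift n) ^ j → ψ x = T ^ j) ∧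
       ((x : Matrix (Fin n) (Fin n) ℂ) = ((lowerShift n) ^ j)ᴴ → ψ x = (T ^ j)ᴴ))) :
    (∀ x : O, (x : Matrix (Fin n) (Fin n) ℂ) = 1 → ψ x = 1) ∧
    (∀ (k : ℕ) (M : Matrix (Fin k) (Fin k) O),
      (∃ R : Matrix (Fin k) (Fin k) (Matrix (Fin n) (Fin n) ℂ),
        M.map (fun x => (x : Matrix (Fin n) (Fin n) ℂ)) = Rᴴ * R) →
      ∃ P : Matrix (Fin k) (Fin k) (Matrix (Fin n) (Fin n) ℂ), M.map ψ = Pᴴ * P) := by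
  obtain ⟨m, rfl⟩ : ∃ m, n = m + 1 := ⟨n - 1, by omega⟩
  change O = shiftSystem (m + 1) at hO
  subst hO
  refine ⟨fun x hx => by simpa using (hψ x 0 (Nat.zero_le _)).1 (by simpa using hx), ?_⟩
  rintro k M ⟨R, hR⟩
  let g : Fin (m + 1) → Fin k → EuclideanSpace ℂ (Fin k × Fin (m + 1)) :=
    fun i p => WithLp.toLp 2 fun a => R a.1 p a.2 i
  have hg : ∀ p q i j, (M p q).1 i j = inner ℂ (g i p) (g j q) := by
    intro p q i j
    have h := congrFun (congrFun (congrFun (congrFun hR p) q) i) j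
    rw [Matrix.mul_apply, Matrix.sum_apply] at h
    rw [PiLp.inner_apply, Fintype.sum_prod_type]
    refine h.trans (Finset.sum_congr rfl fun r _ => ?_)
    rw [Matrix.mul_apply]
    exact Finset.sum_congr rfl fun s _ => mul_comm _ _
  obtain ⟨σ, h, hσ, hh⟩ := inner_eq_sum_of_toeplitz g fun i j p q => by
    rw [← hg, ← hg, apply_succ_succ_of_mem_shiftSystem (M p q).2]
  have hh' : ∀ (d : Fin (m + 1)) p q, inner ℂ (g 0 p) (g d q) =
      ∑ z ∈ σ, z ^ (d : ℕ) * inner ℂ (h z p) (h z q) := by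
    intro d p q
    rw [← inner_conj_symm, hh, map_sum]
    refine Finset.sum_congr rfl fun z _ => ?_
    rw [map_mul, inner_conj_symm, map_pow, Complex.conj_conj]
  apply exists_eq_conjTranspose_mul_self_of_comp_posSemidef
  have key : Matrix.comp _ _ _ _ ℂ (M.map ψ) = ∑ z ∈ σ, Matrix.kroneckerMap (· * ·)
      (Matrix.gram ℂ (h z)) (1 + ∑ d ∈ Finset.Icc 1 m, (starRingEnd ℂ z ^ d • T ^ d +
        starRingEnd ℂ (starRingEnd ℂ z) ^ d • (T ^ d)ᴴ)) := by
    have hM : ∀ p q, ψ (M p q) = ∑ z ∈ σ, inner ℂ (h z p) (h z q) •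
        (1 + ∑ d ∈ Finset.Icc 1 m, (starRingEnd ℂ z ^ d • T ^ d +
          starRingEnd ℂ (starRingEnd ℂ z) ^ d • (T ^ d)ᴴ)) := by
      intro p q
      rw [map_shiftSystem_apply ψ (fun d => T ^ d) (fun d => (T ^ d)ᴴ) (by simp) hψ]
      simp only [smul_add, Finset.sum_add_distrib, Finset.smul_sum, hg, hh, hh', pow_zero]
      rw [Finset.sum_comm (s := σ), Finset.sum_comm (s := σ)]
      congr 1
      · simp [Finset.sum_smul]
      · congr 1 <;>
        · refine Finset.sum_congr rfl fun d hd => ?_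
          have hd' : d % (m + 1) = d :=
            Nat.mod_eq_of_lt (by have := Finset.mem_Icc.1 hd; omega)
          simp [Finset.sum_smul, smul_smul, mul_comm, hd']
    ext ⟨p, i⟩ ⟨q, j⟩
    change ψ (M p q) i j = _
    rw [hM, Matrix.sum_apply, Matrix.sum_apply]
    rfl
  rw [key]
  refine Matrix.posSemidef_sum _ fun z hz => ?_
  exact (Matrix.posSemidef_gram ℂ (h z)).kronecker
    (hpos (starRingEnd ℂ z) (by rw [RCLike.norm_conj, hσ z hz]))
end
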